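/- arXiv:2312.12756 — 5 statements merged into one kernel-verified Lean document; each statement's English description precedes it below -/
import Mathlib

section
/- For every k with 1 ≤ k ≤ n one has Σ_{i=1}^k μ_i ≤ 2 Σ_{i=1}^k λ_i, with equality when k = n. Consequently 2λ - μ is a nonnegative rational linear combination of the vectors e_i - e_{i+1} (1 ≤ i ≤ n-1), i.e. 2λ ≥ μ in the type A dominance order. -/
/-- A vector with total sum zero is the combination of the simple roots `e_i - e_{i+1}` whose
coefficients are its partial sums. -/
theorem eq_sum_partialSums_mul_simpleRoot {R : Type*} [CommRing R] (n : ℕ) (d : ℕ → R)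
    (hd : ∑ i ∈ Finset.Icc 1 n, d i = 0) (j : ℕ) (hj : j ∈ Finset.Icc 1 n) :
    d j = ∑ i ∈ Finset.Icc 1 (n - 1), (∑ l ∈ Finset.Icc 1 i, d l) *
      (if j = i then 1 else if j = i + 1 then -1 else 0) := by
  obtain ⟨hj1, hjn⟩ := Finset.mem_Icc.mp hj
  obtain ⟨p, rfl⟩ : ∃ p, j = p + 1 := ⟨j - 1, by omega⟩
  have split : ∀ i, (∑ l ∈ Finset.Icc 1 i, d l) *
      (if p + 1 = i then 1 else if p + 1 = i + 1 then -1 else 0) =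
      (if p + 1 = i then ∑ l ∈ Finset.Icc 1 i, d l else 0) -
        (if p = i then ∑ l ∈ Finset.Icc 1 i, d l else 0) := by
    intro i
    split_ifs <;> first | omega | simp
  rw [Finset.sum_congr rfl fun i _ => split i, Finset.sum_sub_distrib, Finset.sum_ite_eq,
    Finset.sum_ite_eq]
  have step : ∑ l ∈ Finset.Icc 1 (p + 1), d l = ∑ l ∈ Finset.Icc 1 p, d l + d (p + 1) :=
    Finset.sum_Icc_succ_top (by omega) d
  have upper : (if p + 1 ∈ Finset.Icc 1 (n - 1) then ∑ l ∈ Finset.Icc 1 (p + 1), d l else 0) =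
      ∑ l ∈ Finset.Icc 1 (p + 1), d l := by
    split_ifs with h
    · rfl
    · obtain rfl : n = p + 1 := by rw [Finset.mem_Icc] at h; omega
      exact hd.symm
  have lower : (if p ∈ Finset.Icc 1 (n - 1) then ∑ l ∈ Finset.Icc 1 p, d l else 0) =
      ∑ l ∈ Finset.Icc 1 p, d l := by
    split_ifs with h
    · rfl
    · obtain rfl : p = 0 := by rw [Finset.mem_Icc] at h; omega
      simp
  rw [upper, lower, step]
  ring

/-- Context: n ≥ 3, λ ∈ ℚⁿ weakly decreasing (indices 1..n), 1 ≤ m ≤ n-2,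
μ_j = (2/3)(λ_m + λ_{m+1} + λ_{m+2}) for j ∈ {m, m+1, m+2}, μ_j = 2λ_j otherwise.
STATEMENT 1: for every 1 ≤ k ≤ n, Σ_{i=1}^k μ_i ≤ 2 Σ_{i=1}^k λ_i, with equality
at k = n; consequently 2λ - μ is a nonnegative rational combination of the
vectors e_i - e_{i+1} (1 ≤ i ≤ n-1), i.e. 2λ ≥ μ in type A dominance order. -/
theorem stmt1 (n m : ℕ) (hn : 3 ≤ n) (hm1 : 1 ≤ m) (hm2 : m + 2 ≤ n)
    (lam mu : ℕ → ℚ)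
    (hlam : ∀ i, 1 ≤ i → i < n → lam (i + 1) ≤ lam i)
    (hmu1 : ∀ j, m ≤ j → j ≤ m + 2 →
      mu j = 2 / 3 * (lam m + lam (m + 1) + lam (m + 2)))
    (hmu2 : ∀ j, 1 ≤ j → j ≤ n → (j < m ∨ m + 2 < j) → mu j = 2 * lam j) :
    (∀ k, 1 ≤ k → k ≤ n →
      (∑ i ∈ Finset.Icc 1 k, mu i) ≤ 2 * ∑ i ∈ Finset.Icc 1 k, lam i) ∧
    ((∑ i ∈ Finset.Icc 1 n, mu i) = 2 * ∑ i ∈ Finset.Icc 1 n, lam i) ∧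
    (∃ c : ℕ → ℚ, (∀ i ∈ Finset.Icc 1 (n - 1), 0 ≤ c i) ∧
      ∀ j ∈ Finset.Icc 1 n, 2 * lam j - mu j =
        ∑ i ∈ Finset.Icc 1 (n - 1),
          c i * (if j = i then 1 else if j = i + 1 then -1 else 0)) := by
  have partialSum : ∀ k ≤ n, ∑ i ∈ Finset.Icc 1 k, (2 * lam i - mu i) =
      if k = m then 2 / 3 * (2 * lam m - lam (m + 1) - lam (m + 2))
      else if k = m + 1 then 2 / 3 * (lam m + lam (m + 1) - 2 * lam (m + 2)) else 0 := by
    intro k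
    induction k with
    | zero =>
      intro _
      rw [if_neg (by omega), if_neg (by omega)]
      simp
    | succ k ih =>
      intro hk
      rw [Finset.sum_Icc_succ_top (by omega), ih (by omega)]
      by_cases hout : k + 1 < m ∨ m + 2 < k + 1
      · rw [hmu2 (k + 1) (by omega) hk hout]
        split_ifs <;> first | omega | ring
      · rw [hmu1 (k + 1) (by omega) (by omega)]
        obtain h | h | h : k + 1 = m ∨ k = m ∨ k = m + 1 := by omega
        · rw [if_neg (by omega), if_neg (by omega), if_pos h, h]
          ring
        · subst h
          rw [if_pos rfl, if_neg (by omega), if_pos rfl]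
          ring
        · subst h
          rw [if_neg (by omega), if_pos rfl, if_neg (by omega), if_neg (by omega)]
          ring
  have nonneg : ∀ k ≤ n, 0 ≤ ∑ i ∈ Finset.Icc 1 k, (2 * lam i - mu i) := by
    intro k hk
    have h1 := hlam m hm1 (by omega)
    have h2 : lam (m + 2) ≤ lam (m + 1) := hlam (m + 1) (by omega) (by omega)
    rw [partialSum k hk]
    split_ifs <;> linarith
  have total : ∑ i ∈ Finset.Icc 1 n, (2 * lam i - mu i) = 0 := by
    rw [partialSum n le_rfl, if_neg (by omega), if_neg (by omega)]
  refine ⟨fun k _ hk => ?_, ?_, fun k => ∑ i ∈ Finset.Icc 1 k, (2 * lam i - mu i),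
    fun i hi => nonneg i ?_,
    eq_sum_partialSums_mul_simpleRoot n (fun i => 2 * lam i - mu i) total⟩
  · have h := nonneg k hk
    rw [Finset.sum_sub_distrib, ← Finset.mul_sum] at h
    linarith
  · rw [Finset.sum_sub_distrib, ← Finset.mul_sum] at total
    linarith
  · rw [Finset.mem_Icc] at hi
    omega
end

section
/- A point μ ∈ ℝ^n is an extreme point of D_λ if and only if there exist integers 0 = c_0 < c_1 < ... < c_r = n such that for every t ∈ {1,...,r} and every j with c_{t-1} < j ≤ c_t, μ_j = (λ_{c_{t-1}+1} + λ_{c_{t-1}+2} + ... + λ_{c_t})/(c_t - c_{t-1}); that is, the extreme points of D_λ are exactly the vectors obtained from λ by replacing its entries on each block of a partition of {1,...,n} into consecutive intervals by their average. (This is the type A instance of the description of the vertices v_I(λ) of the dominant weight polytope.) -/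
namespace DominantWeight

/-- The sum of the first `k` entries of `ν`. -/
noncomputable def partialSum {n : ℕ} (ν : Fin n → ℝ) (k : ℕ) : ℝ :=
  ∑ i : Fin n, if (i : ℕ) < k then ν i else 0

/-- The type A dominant weight polytope of `lam`. -/
def polytope {n : ℕ} (lam : Fin n → ℝ) : Set (Fin n → ℝ) :=
  {ν : Fin n → ℝ | (∀ i j : Fin n, i ≤ j → ν j ≤ ν i) ∧
    (∀ k, 1 ≤ k → k ≤ n - 1 →
      (∑ i : Fin n, if (i : ℕ) < k then ν i else 0) ≤
        ∑ i : Fin n, if (i : ℕ) < k then lam i else 0) ∧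
    (∑ i, ν i) = ∑ i, lam i}

section PartialSum

variable {n : ℕ}

@[simp]
lemma partialSum_zero (ν : Fin n → ℝ) : partialSum ν 0 = 0 := by
  simp [partialSum]

lemma partialSum_self (ν : Fin n → ℝ) : partialSum ν n = ∑ i, ν i := by
  simp [partialSum]

lemma partialSum_succ (ν : Fin n → ℝ) (i : Fin n) :
    partialSum ν (i + 1) = partialSum ν i + ν i := by
  unfold partialSum
  have h : ν i = ∑ j : Fin n, if j = i then ν j else 0 := by simp
  rw [h, ← Finset.sum_add_distrib]
  refine Finset.sum_congr rfl fun j _ => ?_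
  have := @Fin.ext_iff n j i
  split_ifs <;> first | omega | simp

lemma partialSum_add_smul (ν d : Fin n → ℝ) (a b : ℝ) (k : ℕ) :
    partialSum (a • ν + b • d) k = a * partialSum ν k + b * partialSum d k := by
  unfold partialSum
  rw [Finset.mul_sum, Finset.mul_sum, ← Finset.sum_add_distrib]
  refine Finset.sum_congr rfl fun j _ => ?_
  split_ifs <;> simp

lemma partialSum_telescope (E : ℕ → ℝ) {k : ℕ} (hk : k ≤ n) :
    partialSum (fun i : Fin n => E (i + 1) - E i) k = E k - E 0 := by
  induction k with
  | zero => simp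
  | succ k ih =>
    have := partialSum_succ (fun i : Fin n => E (i + 1) - E i) ⟨k, hk⟩
    simp only at this
    rw [this, ih (by omega)]
    ring

lemma eq_of_partialSum_eq {ν ν' : Fin n → ℝ}
    (h : ∀ k ≤ n, partialSum ν k = partialSum ν' k) : ν = ν' := by
  ext i
  have h₁ := partialSum_succ ν i
  have h₂ := partialSum_succ ν' i
  have h₃ := h i (by omega)
  have h₄ := h (i + 1) (by omega)
  linarith

lemma sum_block_eq (ν : Fin n → ℝ) {u v : ℕ} (huv : u ≤ v) :
    (∑ i : Fin n, if u < (i : ℕ) + 1 ∧ (i : ℕ) + 1 ≤ v then ν i else 0) =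
      partialSum ν v - partialSum ν u := by
  unfold partialSum
  rw [← Finset.sum_sub_distrib]
  refine Finset.sum_congr rfl fun j _ => ?_
  split_ifs <;> first | omega | simp

lemma antitone_iff_partialSum_concave (ν : Fin n → ℝ) :
    (∀ i j : Fin n, i ≤ j → ν j ≤ ν i) ↔
      ∀ k, k + 2 ≤ n → partialSum ν (k + 2) + partialSum ν k ≤ 2 * partialSum ν (k + 1) := by
  constructor
  · intro h k hk
    have h₁ := partialSum_succ ν ⟨k, by omega⟩
    have h₂ := partialSum_succ ν ⟨k + 1, by omega⟩
    have h₃ := h ⟨k, by omega⟩ ⟨k + 1, by omega⟩ (by simp)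
    simp only at h₁ h₂
    linarith
  · intro h
    have key : ∀ (i m : ℕ) (hm : i + m < n), ν ⟨i + m, hm⟩ ≤ ν ⟨i, by omega⟩ := by
      intro i m
      induction m with
      | zero => intro _; simp
      | succ m ih =>
        intro hm
        have h₁ := partialSum_succ ν ⟨i + m, by omega⟩
        have h₂ := partialSum_succ ν ⟨i + m + 1, by omega⟩
        have h₃ := h (i + m) (by omega)
        have h₄ := ih (by omega)
        simp only at h₁ h₂
        change ν ⟨i + m + 1, _⟩ ≤ _
        linarith
    intro i j hij
    have hij' : (i : ℕ) ≤ j := hij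
    have := key i (j - i) (by omega)
    simpa [Nat.add_sub_cancel' hij'] using this

lemma mem_polytope_iff {lam ν : Fin n → ℝ} :
    ν ∈ polytope lam ↔
      (∀ k, k + 2 ≤ n → partialSum ν (k + 2) + partialSum ν k ≤ 2 * partialSum ν (k + 1)) ∧
      (∀ k ≤ n, partialSum ν k ≤ partialSum lam k) ∧ partialSum ν n = partialSum lam n := by
  unfold polytope
  rw [Set.mem_ofPred_eq, antitone_iff_partialSum_concave, ← partialSum_self, ← partialSum_self]
  refine and_congr_right fun _ => ⟨fun ⟨h, e⟩ => ⟨fun k hk => ?_, e⟩, fun ⟨h, e⟩ =>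
    ⟨fun k _ hk => h k (by omega), e⟩⟩
  rcases Nat.eq_zero_or_pos k with rfl | h0
  · simp
  · rcases hk.eq_or_lt with rfl | hk
    · exact e.le
    · exact h k h0 (by omega)

end PartialSum

/-- Discrete maximum principle. -/
lemma nonpos_of_subharmonic {n : ℕ} {E : ℕ → ℝ} (h0 : E 0 ≤ 0) (hn : E n ≤ 0)
    (h : ∀ k, k + 2 ≤ n → E (k + 1) ≤ 0 ∨ 2 * E (k + 1) ≤ E (k + 2) + E k) :
    ∀ k ≤ n, E k ≤ 0 := by
  classical
  have hex : ∃ m, m ≤ n ∧ ∀ j ≤ n, E j ≤ E m := by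
    obtain ⟨m, hm, hmax⟩ := Finset.exists_max_image (Finset.range (n + 1)) E ⟨0, by simp⟩
    exact ⟨m, by simpa [Nat.lt_succ_iff] using hm,
      fun j hj => hmax j (by simpa [Nat.lt_succ_iff] using hj)⟩
  obtain ⟨hmn, hmax⟩ := Nat.find_spec hex
  have hmin := fun p => @Nat.find_min _ _ hex p
  generalize Nat.find hex = m at hmn hmax hmin
  suffices E m ≤ 0 from fun k hk => (hmax k hk).trans this
  by_contra! hpos
  rcases m with _ | p
  · linarith
  · rcases hmn.eq_or_lt with rfl | hlt
    · linarith
    · rcases h p (by omega) with h | h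
      · linarith
      · have := hmax (p + 2) (by omega)
        refine hmin p (by omega) ⟨by omega, fun j hj => ?_⟩
        linarith [hmax j hj]

lemma eq_affine_of_flat {P : ℕ → ℝ} {u v : ℕ}
    (h : ∀ k, u ≤ k → k + 2 ≤ v → P (k + 2) + P k = 2 * P (k + 1)) (m : ℕ) (hm : u + m ≤ v) :
    P (u + m) = P u + m * (P (u + 1) - P u) := by
  induction m using Nat.strong_induction_on with
  | _ m ih =>
    match m with
    | 0 => simp
    | 1 => simp
    | m + 2 =>
      have h₁ := ih m (by omega) (by omega)
      have h₂ := ih (m + 1) (by omega) (by omega)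
      have h₃ := h (u + m) (by omega) (by omega)
      simp only [← add_assoc] at h₂ ⊢
      push_cast at h₂ ⊢
      linarith

lemma exists_last_lt (Q : ℕ → Prop) (h0 : Q 0) {k : ℕ} (hk : 0 < k) :
    ∃ a < k, Q a ∧ ∀ j, a < j → j < k → ¬ Q j := by
  classical
  refine ⟨Nat.findGreatest Q (k - 1), ?_, Nat.findGreatest_spec (Nat.zero_le _) h0,
    fun j h₁ h₂ => Nat.findGreatest_is_greatest h₁ (by omega)⟩
  have := Nat.findGreatest_le (P := Q) (k - 1)
  omega

lemma exists_first_gt (Q : ℕ → Prop) {n k : ℕ} (hn : Q n) (hk : k < n) :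
    ∃ b ≤ n, k < b ∧ Q b ∧ ∀ j, k < j → j < b → ¬ Q j := by
  classical
  have hex : ∃ b, k < b ∧ Q b := ⟨n, hk, hn⟩
  exact ⟨Nat.find hex, Nat.find_min' hex ⟨hk, hn⟩, (Nat.find_spec hex).1, (Nat.find_spec hex).2,
    fun j h₁ h₂ hQ => Nat.find_min hex h₂ ⟨h₁, hQ⟩⟩

/-- Enumeration of the numbers up to `m` that satisfy `Q`. -/
lemma exists_enumeration (Q : ℕ → Prop) (h0 : Q 0) (m : ℕ) (hm : Q m) :
    ∃ (r : ℕ) (c : ℕ → ℕ), c 0 = 0 ∧ c r = m ∧ (∀ t, t < r → c t < c (t + 1)) ∧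
      ∀ t, t < r → Q (c t) ∧ Q (c (t + 1)) ∧ ∀ j, c t < j → j < c (t + 1) → ¬ Q j := by
  induction m using Nat.strong_induction_on with
  | _ m ih =>
    rcases Nat.eq_zero_or_pos m with rfl | hpos
    · exact ⟨0, fun _ => 0, rfl, rfl, by simp, by simp⟩
    · obtain ⟨a, ham, ha, hgap⟩ := exists_last_lt Q h0 hpos
      obtain ⟨r, c, c0, cr, hc, hQ⟩ := ih a ham ha
      refine ⟨r + 1, fun t => if t ≤ r then c t else m, by simpa using c0, by simp, ?_, ?_⟩
      · intro t ht
        rcases (Nat.lt_succ_iff.mp ht).eq_or_lt with rfl | ht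
        · simpa [cr] using ham
        · simpa [ht.le, Nat.succ_le_of_lt ht] using hc t ht
      · intro t ht
        rcases (Nat.lt_succ_iff.mp ht).eq_or_lt with rfl | ht
        · simpa [cr] using ⟨ha, hm, hgap⟩
        · simpa [ht.le, Nat.succ_le_of_lt ht] using hQ t ht

lemma exists_block {c : ℕ → ℕ} (c0 : c 0 = 0) (r : ℕ) {j : ℕ} (hj : j < c r) :
    ∃ t < r, c t ≤ j ∧ j < c (t + 1) := by
  induction r with
  | zero => omega
  | succ r ih =>
    by_cases h : j < c r
    · obtain ⟨t, ht, h⟩ := ih h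
      exact ⟨t, by omega, h⟩
    · exact ⟨r, by omega, by omega, hj⟩

lemma le_last {c : ℕ → ℕ} {r : ℕ} (hc : ∀ t, t < r → c t < c (t + 1)) {t : ℕ} (ht : t ≤ r) :
    c t ≤ c r := by
  induction r, ht using Nat.le_induction with
  | base => rfl
  | succ m hm ih => exact (ih fun t ht => hc t (by omega)).trans (hc m (by omega)).le

section Tight

variable {n : ℕ}

/-- At each interior position either the majorization inequality or the monotonicity inequality
is an equality. -/
def IsTight (lam ν : Fin n → ℝ) : Prop :=
  ∀ k, k + 2 ≤ n → partialSum ν (k + 1) = partialSum lam (k + 1) ∨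
    partialSum ν (k + 2) + partialSum ν k = 2 * partialSum ν (k + 1)

/-- `ν` is obtained from `lam` by averaging over the blocks of a partition into intervals. -/
def IsBlockAverage (lam ν : Fin n → ℝ) : Prop :=
  ∃ (r : ℕ) (c : ℕ → ℕ), c 0 = 0 ∧ c r = n ∧ (∀ t, t < r → c t < c (t + 1)) ∧
    ∀ t, 1 ≤ t → t ≤ r → ∀ j : Fin n, c (t - 1) < (j : ℕ) + 1 → (j : ℕ) + 1 ≤ c t →
      ν j = (∑ i : Fin n,
          if c (t - 1) < (i : ℕ) + 1 ∧ (i : ℕ) + 1 ≤ c t then lam i else 0)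
        / ((c t : ℝ) - (c (t - 1) : ℝ))

lemma IsTight.isBlockAverage {lam ν : Fin n → ℝ} (h : IsTight lam ν)
    (hν : partialSum ν n = partialSum lam n) : IsBlockAverage lam ν := by
  obtain ⟨r, c, c0, cr, hc, hQ⟩ := exists_enumeration
    (fun k => partialSum ν k = partialSum lam k) (by simp) n hν
  refine ⟨r, c, c0, cr, hc, ?_⟩
  rintro (_ | t) ht htr j hj₁ hj₂
  · omega
  simp only [Nat.add_sub_cancel] at hj₁ ⊢
  obtain ⟨h₁, h₂, hgap⟩ := hQ t (by omega)
  have hlt := hc t (by omega)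
  have hle : c (t + 1) ≤ n := cr ▸ le_last hc htr
  have haff := eq_affine_of_flat (P := partialSum ν) (u := c t) (v := c (t + 1))
    fun k hk₁ hk₂ => (h k (by omega)).resolve_left (hgap _ (by omega) (by omega))
  rw [sum_block_eq _ hlt.le, ← h₁, ← h₂]
  obtain ⟨m, hm⟩ := Nat.exists_eq_add_of_lt hlt
  obtain ⟨p, hp⟩ := Nat.exists_eq_add_of_le (show c t ≤ j by omega)
  have e₁ := haff (m + 1) (by omega)
  have e₂ := haff p (by omega)
  have e₃ := haff (p + 1) (by omega)
  have e₄ := partialSum_succ ν j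
  rw [hp, add_assoc] at e₄
  have hne : ((c (t + 1) : ℝ) - c t) = m + 1 := by rw [hm]; push_cast; ring
  have hm0 : (m : ℝ) + 1 ≠ 0 := by positivity
  rw [hne, hm, add_assoc, e₁, eq_div_iff hm0]
  push_cast at e₃ ⊢
  have : ν j = partialSum ν (c t + 1) - partialSum ν (c t) := by linarith
  rw [this]
  ring

lemma IsBlockAverage.isTight {lam ν : Fin n → ℝ} (h : IsBlockAverage lam ν) :
    IsTight lam ν ∧ partialSum ν n = partialSum lam n := by
  obtain ⟨r, c, c0, cr, hc, hν⟩ := h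
  have hval : ∀ t < r, ∃ x : ℝ, x * ((c (t + 1) : ℝ) - c t) =
      partialSum lam (c (t + 1)) - partialSum lam (c t) ∧
      ∀ j : Fin n, c t ≤ j → j < c (t + 1) → ν j = x := by
    intro t ht
    have hlt := hc t ht
    have hne : (c (t + 1) : ℝ) - c t ≠ 0 := by
      have : (c t : ℝ) < c (t + 1) := by exact_mod_cast hlt
      linarith
    refine ⟨_, div_mul_cancel₀ _ hne, fun j h₁ h₂ => ?_⟩
    rw [hν (t + 1) (by omega) (by omega) j (by simp; omega) (by omega)]
    simp only [Nat.add_sub_cancel]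
    rw [sum_block_eq _ hlt.le]
  have hcut : ∀ t ≤ r, partialSum ν (c t) = partialSum lam (c t) := by
    intro t
    induction t with
    | zero => simp [c0]
    | succ t ih =>
      intro ht
      obtain ⟨x, hx, hνx⟩ := hval t ht
      have hle : c (t + 1) ≤ n := cr ▸ le_last hc ht
      have hlt := hc t ht
      have hlin : ∀ m, c t + m ≤ c (t + 1) →
          partialSum ν (c t + m) = partialSum ν (c t) + m * x := by
        intro m
        induction m with
        | zero => simp
        | succ m ihm =>
          intro hm
          have e := partialSum_succ ν ⟨c t + m, by omega⟩
          rw [hνx _ (by simp) (by simp only; omega)] at e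
          simp only at e
          rw [← add_assoc, e, ihm (by omega)]
          push_cast
          ring
      obtain ⟨m, hm⟩ := Nat.exists_eq_add_of_le hlt.le
      have e := hlin m hm.ge
      rw [← hm, ih (by omega)] at e
      have : (c (t + 1) : ℝ) = c t + m := by exact_mod_cast hm
      rw [this] at hx
      linarith
  refine ⟨fun k hk => ?_, by simpa [cr] using hcut r le_rfl⟩
  obtain ⟨t, ht, h₁, h₂⟩ := exists_block c0 r (j := k + 1) (by omega)
  rcases h₁.eq_or_lt with h₁ | h₁
  · exact Or.inl (h₁ ▸ hcut t ht.le)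
  · right
    obtain ⟨x, -, hνx⟩ := hval t ht
    have e₁ := partialSum_succ ν ⟨k, by omega⟩
    have e₂ := partialSum_succ ν ⟨k + 1, by omega⟩
    rw [hνx _ (by simp only; omega) (by simp only; omega)] at e₁ e₂
    simp only at e₁ e₂
    linarith

lemma IsTight.mem_polytope {lam ν : Fin n → ℝ} (hlam : ∀ i j : Fin n, i ≤ j → lam j ≤ lam i)
    (h : IsTight lam ν) (hν : partialSum ν n = partialSum lam n) : ν ∈ polytope lam := by
  have hconc := (antitone_iff_partialSum_concave lam).mp hlam
  have hle : ∀ k ≤ n, partialSum ν k - partialSum lam k ≤ 0 := by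
    refine nonpos_of_subharmonic (by simp) (by linarith) fun k hk => ?_
    rcases h k hk with h | h
    · exact Or.inl (by linarith)
    · exact Or.inr (by linarith [hconc k hk])
  refine mem_polytope_iff.mpr ⟨fun k hk => ?_, fun k hk => by linarith [hle k hk], hν⟩
  rcases h k hk with h | h
  · linarith [hconc k hk, hle k (by omega), hle (k + 2) hk]
  · exact h.le

lemma IsTight.mem_extremePoints {lam ν : Fin n → ℝ} (h : IsTight lam ν)
    (hν : ν ∈ polytope lam) : ν ∈ (polytope lam).extremePoints ℝ := by
  refine ⟨hν, ?_⟩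
  rintro x hx y hy ⟨a, b, ha, hb, hab, rfl⟩
  rw [mem_polytope_iff] at hx hy hν
  obtain ⟨hx₁, hx₂, hx₃⟩ := hx
  obtain ⟨hy₁, hy₂, hy₃⟩ := hy
  obtain ⟨-, -, hν₃⟩ := hν
  unfold IsTight at h
  set z := a • x + b • y with hz
  have hzP : ∀ k, partialSum z k = a * partialSum x k + b * partialSum y k :=
    partialSum_add_smul x y a b
  obtain rfl : b = 1 - a := by linarith
  have htight : ∀ k, k + 2 ≤ n →
      (partialSum x (k + 1) - partialSum z (k + 1) = 0) ∨
        partialSum x (k + 2) - partialSum z (k + 2) + (partialSum x k - partialSum z k) =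
          2 * (partialSum x (k + 1) - partialSum z (k + 1)) := by
    intro k hk
    rcases h k hk with h | h
    · left
      rw [h]
      rw [hzP] at h
      have := hx₂ (k + 1) (by omega)
      have := hy₂ (k + 1) (by omega)
      nlinarith
    · right
      have : partialSum x (k + 2) + partialSum x k = 2 * partialSum x (k + 1) := by
        have := hx₁ k hk
        have := hy₁ k hk
        simp only [hzP] at h
        nlinarith
      linarith
  refine eq_of_partialSum_eq fun k hk => le_antisymm ?_ ?_
  · refine sub_nonpos.mp (nonpos_of_subharmonic
      (E := fun k => partialSum x k - partialSum z k) (by simp) (by linarith) ?_ k hk)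
    exact fun k hk => (htight k hk).imp (fun h => h.le) fun h => h.ge
  · refine sub_nonpos.mp (nonpos_of_subharmonic
      (E := fun k => partialSum z k - partialSum x k) (by simp) (by linarith) ?_ k hk)
    exact fun k hk => (htight k hk).imp (fun h => by linarith) fun h => by linarith

/-- A direction that respects the active constraints at `ν` keeps a small perturbation of `ν` in
the polytope. -/
lemma eventually_mem_polytope {lam ν d : Fin n → ℝ} (hν : ν ∈ polytope lam)
    (hconc : ∀ k, k + 2 ≤ n → partialSum ν (k + 2) + partialSum ν k = 2 * partialSum ν (k + 1) →
      partialSum d (k + 2) + partialSum d k = 2 * partialSum d (k + 1))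
    (hle : ∀ k ≤ n, partialSum ν k = partialSum lam k → partialSum d k = 0) :
    ∀ᶠ ε in nhds (0 : ℝ), ν + ε • d ∈ polytope lam := by
  obtain ⟨h₁, h₂, h₃⟩ := mem_polytope_iff.mp hν
  have hsum : ∀ (ε : ℝ) k, partialSum (ν + ε • d) k = partialSum ν k + ε * partialSum d k := by
    intro ε k
    simpa using partialSum_add_smul ν d 1 ε k
  have hev : ∀ x y x' y' : ℝ, x ≤ y → (x = y → x' = y') →
      ∀ᶠ ε in nhds (0 : ℝ), x + ε * x' ≤ y + ε * y' := by
    intro x y x' y' hxy himp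
    rcases hxy.eq_or_lt with rfl | hlt
    · simp [himp rfl]
    · have hcont : ∀ p q : ℝ, Filter.Tendsto (fun ε : ℝ => p + ε * q) (nhds 0) (nhds p) := by
        intro p q
        have : Continuous fun ε : ℝ => p + ε * q := by fun_prop
        simpa using this.tendsto 0
      exact ((hcont x x').eventually_lt (hcont y y') hlt).mono fun _ h => h.le
  have hA : ∀ᶠ ε in nhds (0 : ℝ), ∀ k ∈ Finset.range (n + 1), k + 2 ≤ n →
      partialSum (ν + ε • d) (k + 2) + partialSum (ν + ε • d) k ≤
        2 * partialSum (ν + ε • d) (k + 1) := by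
    rw [Filter.eventually_all_finset]
    intro k _
    by_cases hk : k + 2 ≤ n
    · refine (hev _ _ _ _ (h₁ k hk) (hconc k hk)).mono fun ε h _ => ?_
      simp only [hsum]
      linarith
    · exact Filter.Eventually.of_forall fun _ h => absurd h hk
  have hB : ∀ᶠ ε in nhds (0 : ℝ), ∀ k ∈ Finset.range (n + 1),
      partialSum (ν + ε • d) k ≤ partialSum lam k := by
    rw [Filter.eventually_all_finset]
    intro k hk
    have hk : k ≤ n := by simpa [Nat.lt_succ_iff] using hk
    refine (hev _ _ _ 0 (h₂ k hk) (hle k hk)).mono fun ε h => ?_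
    rw [hsum]
    linarith
  filter_upwards [hA, hB] with ε hA hB
  refine mem_polytope_iff.mpr ⟨fun k hk => hA k (by simp; omega) hk,
    fun k hk => hB k (by simp; omega), ?_⟩
  rw [hsum, hle n le_rfl h₃, h₃]
  ring

/-- The piecewise linear function supported on `[a, b]` with its peak at `k`. -/
noncomputable def hat (a k b j : ℕ) : ℝ :=
  if j ≤ a then 0 else if j ≤ k then ((j : ℝ) - a) * (b - k)
    else if j ≤ b then ((b : ℝ) - j) * (k - a) else 0

lemma hat_flat {a k b j : ℕ} (hak : a < k) (hkb : k < b) (ha : j + 1 ≠ a) (hk : j + 1 ≠ k)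
    (hb : j + 1 ≠ b) : hat a k b (j + 2) + hat a k b j = 2 * hat a k b (j + 1) := by
  have key : j + 2 ≤ a ∨ (a ≤ j ∧ j + 2 ≤ k) ∨ (k ≤ j ∧ j + 2 ≤ b) ∨ b ≤ j := by omega
  have left : ∀ i, a ≤ i → i ≤ k → hat a k b i = ((i : ℝ) - a) * (b - k) := by
    intro i h₁ h₂
    unfold hat
    split_ifs with h
    · obtain rfl : i = a := by omega
      simp
    · rfl
  have right : ∀ i, k ≤ i → i ≤ b → hat a k b i = ((b : ℝ) - i) * (k - a) := by
    intro i h₁ h₂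
    unfold hat
    split_ifs with h h'
    · omega
    · obtain rfl : i = k := by omega
      ring
    · rfl
  have above : ∀ i, b ≤ i → hat a k b i = 0 := by
    intro i h₁
    unfold hat
    split_ifs with h h' h''
    · rfl
    · omega
    · obtain rfl : i = b := by omega
      simp
    · rfl
  rcases key with h | h | h | h
  · unfold hat
    rw [if_pos (by omega), if_pos (by omega), if_pos (by omega)]
    ring
  · rw [left _ (by omega) (by omega), left _ (by omega) (by omega), left _ (by omega) (by omega)]
    push_cast
    ring
  · rw [right _ (by omega) (by omega), right _ (by omega) (by omega),
      right _ (by omega) (by omega)]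
    push_cast
    ring
  · rw [above _ (by omega), above _ (by omega), above _ (by omega)]
    ring

lemma hat_eq_zero {a k b j : ℕ} (hkb : k < b) (h : j ≤ a ∨ b ≤ j) : hat a k b j = 0 := by
  unfold hat
  split_ifs with h₁ h₂ h₃
  · rfl
  · omega
  · obtain rfl : j = b := by omega
    simp
  · rfl

lemma hat_peak_pos {a k b : ℕ} (hak : a < k) (hkb : k < b) : 0 < hat a k b k := by
  unfold hat
  rw [if_neg (by omega), if_pos le_rfl]
  have h₁ : (a : ℝ) < k := by exact_mod_cast hak
  have h₂ : (k : ℝ) < b := by exact_mod_cast hkb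
  exact mul_pos (by linarith) (by linarith)

lemma isTight_of_mem_extremePoints {lam ν : Fin n → ℝ}
    (hlam : ∀ i j : Fin n, i ≤ j → lam j ≤ lam i)
    (h : ν ∈ (polytope lam).extremePoints ℝ) : IsTight lam ν := by
  obtain ⟨hν, hext⟩ := h
  obtain ⟨-, h₂, h₃⟩ := mem_polytope_iff.mp hν
  have hlamc := (antitone_iff_partialSum_concave lam).mp hlam
  intro k₀ hk₀
  by_contra! hcon
  obtain ⟨hk, hbreak⟩ := hcon
  -- An active majorization inequality at a flat position forces its neighbours to be active.
  have hprop : ∀ j, j + 2 ≤ n → partialSum ν (j + 1) = partialSum lam (j + 1) →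
      partialSum ν (j + 2) + partialSum ν j = 2 * partialSum ν (j + 1) →
      partialSum ν j = partialSum lam j ∧ partialSum ν (j + 2) = partialSum lam (j + 2) := by
    intro j hj e f
    have := hlamc j hj
    have := h₂ j (by omega)
    have := h₂ (j + 2) hj
    constructor <;> linarith
  let Q : ℕ → Prop := fun j => partialSum ν j = partialSum lam j ∨
    ∃ i, i + 1 = j ∧ partialSum ν (i + 2) + partialSum ν i ≠ 2 * partialSum ν (i + 1)
  obtain ⟨a, hak, hQa, hgapa⟩ := exists_last_lt Q (Or.inl (by simp)) (Nat.succ_pos k₀)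
  obtain ⟨b, hbn, hkb, hQb, hgapb⟩ :=
    exists_first_gt Q (k := k₀ + 1) (n := n) (Or.inl h₃) (by omega)
  have hgap : ∀ j, a < j → j < b → partialSum ν j ≠ partialSum lam j := by
    intro j hj₁ hj₂ e
    rcases lt_trichotomy j (k₀ + 1) with hj | rfl | hj
    · exact hgapa j hj₁ hj (Or.inl e)
    · exact hk e
    · exact hgapb j hj hj₂ (Or.inl e)
  have hflata : ∀ i, i + 1 = a →
      partialSum ν (i + 2) + partialSum ν i ≠ 2 * partialSum ν (i + 1) := by
    rintro i rfl f
    rcases hQa with e | ⟨i', hi', e⟩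
    · exact hgap (i + 2) (by omega) (by omega) (hprop i (by omega) e f).2
    · obtain rfl : i' = i := by omega
      exact e f
  have hflatb : ∀ i, i + 2 ≤ n → i + 1 = b →
      partialSum ν (i + 2) + partialSum ν i ≠ 2 * partialSum ν (i + 1) := by
    rintro i hi rfl f
    rcases hQb with e | ⟨i', hi', e⟩
    · exact hgap i (by omega) (by omega) (hprop i hi e f).1
    · obtain rfl : i' = i := by omega
      exact e f
  set d : Fin n → ℝ := fun i => hat a (k₀ + 1) b (i + 1) - hat a (k₀ + 1) b i with hd
  have hdsum : ∀ j ≤ n, partialSum d j = hat a (k₀ + 1) b j := by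
    intro j hj
    rw [hd, partialSum_telescope _ hj, hat_eq_zero hkb (Or.inl (Nat.zero_le a)), sub_zero]
  have hev := eventually_mem_polytope (d := d) hν
    (by
      intro j hj f
      rw [hdsum _ (by omega), hdsum _ (by omega), hdsum _ (by omega)]
      refine hat_flat hak hkb (fun e => hflata j e f) (fun e => ?_) fun e => hflatb j hj e f
      obtain rfl : j = k₀ := by omega
      exact hbreak f)
    (by
      intro j hj e
      rw [hdsum j hj]
      refine hat_eq_zero hkb ?_
      by_contra! hcon
      exact hgap j hcon.1 hcon.2 e)
  obtain ⟨δ, hδ, hball⟩ := Metric.eventually_nhds_iff.mp hev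
  have hplus := hball (y := δ / 2) (by simp [abs_of_pos hδ, hδ])
  have hminus := hball (y := -(δ / 2)) (by simp [abs_of_pos hδ, hδ])
  have hfix := hext hplus hminus
    ⟨1 / 2, 1 / 2, by norm_num, by norm_num, by norm_num, by ext i; simp; ring⟩
  have hzero := congrArg (fun x => partialSum x (k₀ + 1)) hfix
  have hadd := partialSum_add_smul ν d 1 (δ / 2) (k₀ + 1)
  rw [one_smul, hdsum _ (by omega)] at hadd
  have := mul_pos (half_pos hδ) (hat_peak_pos hak hkb)
  linarith

end Tight

end DominantWeight

/-- Context: n ≥ 1, λ ∈ ℝⁿ weakly decreasing; D_λ is the type A dominant weight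
polytope of λ.
STATEMENT 11: μ is an extreme point of D_λ iff there are 0 = c_0 < c_1 < ... <
c_r = n such that on each 1-based index block (c_{t-1}, c_t] the entries of μ
are the average of the corresponding entries of λ. -/
theorem stmt11 (n : ℕ) (hn : 1 ≤ n) (lam : Fin n → ℝ)
    (hlam : ∀ i j : Fin n, i ≤ j → lam j ≤ lam i) (mu : Fin n → ℝ) :
    mu ∈ Set.extremePoints ℝ
      {ν : Fin n → ℝ | (∀ i j : Fin n, i ≤ j → ν j ≤ ν i) ∧
        (∀ k, 1 ≤ k → k ≤ n - 1 →
          (∑ i : Fin n, if (i : ℕ) < k then ν i else 0) ≤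
            ∑ i : Fin n, if (i : ℕ) < k then lam i else 0) ∧
        (∑ i, ν i) = ∑ i, lam i} ↔
    ∃ (r : ℕ) (c : ℕ → ℕ), c 0 = 0 ∧ c r = n ∧ (∀ t, t < r → c t < c (t + 1)) ∧
      ∀ t, 1 ≤ t → t ≤ r → ∀ j : Fin n, c (t - 1) < (j : ℕ) + 1 → (j : ℕ) + 1 ≤ c t →
        mu j = (∑ i : Fin n,
            if c (t - 1) < (i : ℕ) + 1 ∧ (i : ℕ) + 1 ≤ c t then lam i else 0)
          / ((c t : ℝ) - (c (t - 1) : ℝ)) := by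
  change mu ∈ (DominantWeight.polytope lam).extremePoints ℝ ↔ DominantWeight.IsBlockAverage lam mu
  constructor
  · intro h
    exact (DominantWeight.isTight_of_mem_extremePoints hlam h).isBlockAverage
      (DominantWeight.mem_polytope_iff.mp h.1).2.2
  · intro h
    obtain ⟨ht, hsum⟩ := h.isTight
    exact ht.mem_extremePoints (ht.mem_polytope hlam hsum)
end

section
/- Every extreme point of D_{λ+ν} can be written as a + b where a is an extreme point of D_λ and b is an extreme point of D_ν. (This is the type A instance of the fact that any vertex of the dominant weight polytope of a sum is a sum of vertices.) -/
/-- The type A dominant weight polytope D_x of a weakly decreasing x ∈ ℝⁿ: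
weakly decreasing ν with all partial sums dominated by those of x and equal
total sum. -/
def domWtPolytopeA (n : ℕ) (x : Fin n → ℝ) : Set (Fin n → ℝ) :=
  {ν : Fin n → ℝ | (∀ i j : Fin n, i ≤ j → ν j ≤ ν i) ∧
    (∀ k, 1 ≤ k → k ≤ n - 1 →
      (∑ i : Fin n, if (i : ℕ) < k then ν i else 0) ≤
        ∑ i : Fin n, if (i : ℕ) < k then x i else 0) ∧
    (∑ i, ν i) = ∑ i, x i}

open Finset in
/-- The average of `x` over the fibre of `f` through `i`. -/
noncomputable def fiberAverage {ι : Type*} [Fintype ι] (f x : ι → ℝ) (i : ι) : ℝ :=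
  (∑ j with f j = f i, x j) / (#{j | f j = f i} : ℝ)

section FiberAverage

open Finset

variable {ι : Type*} [Fintype ι]

theorem card_fiber_pos (f : ι → ℝ) (i : ι) : (0 : ℝ) < #{j | f j = f i} := by
  exact_mod_cast card_pos.2 ⟨i, by simp⟩

theorem fiberAverage_congr (f x : ι → ℝ) {i j : ι} (h : f i = f j) :
    fiberAverage f x i = fiberAverage f x j := by
  simp only [fiberAverage, h]

theorem fiberAverage_add (f x y : ι → ℝ) :
    fiberAverage f (x + y) = fiberAverage f x + fiberAverage f y := by
  funext i
  simp [fiberAverage, sum_add_distrib, add_div]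

/-- A sum of fibre averages against weights `w`, restricted to one fibre. -/
theorem sum_fiber_mul_fiberAverage (f x w : ι → ℝ) (i : ι) :
    ∑ j with f j = f i, w j * fiberAverage f x j =
      (∑ j with f j = f i, w j) * (∑ j with f j = f i, x j) / (#{j | f j = f i} : ℝ) := by
  rw [mul_div_assoc, sum_mul]
  refine sum_congr rfl fun j hj => ?_
  rw [fiberAverage_congr f x (mem_filter.1 hj).2, fiberAverage]

theorem sum_mul_fiberAverage_le [LinearOrder ι] (f : ι → ℝ) {x w : ι → ℝ}
    (hx : Antitone x) (hw : Antitone w) :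
    ∑ i, w i * fiberAverage f x i ≤ ∑ i, w i * x i := by
  rw [← sum_fiberwise_of_maps_to (s := univ) (t := univ.image f) (g := f) (by simp),
    ← sum_fiberwise_of_maps_to (s := univ) (t := univ.image f) (g := f) (by simp)]
  refine sum_le_sum fun c hc => ?_
  obtain ⟨i, -, rfl⟩ := mem_image.1 hc
  rw [sum_fiber_mul_fiberAverage, div_le_iff₀ (card_fiber_pos f i), mul_comm _ (#_ : ℝ)]
  exact ((hw.monovary hx).monovaryOn _).sum_mul_sum_le_card_mul_sum

theorem sum_filter_fiberAverage (f x : ι → ℝ) (p : ℝ → Prop) [DecidablePred p] :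
    ∑ i with p (f i), fiberAverage f x i = ∑ i with p (f i), x i := by
  rw [sum_filter, sum_filter,
    ← sum_fiberwise_of_maps_to (s := univ) (t := univ.image f) (g := f) (by simp),
    ← sum_fiberwise_of_maps_to (s := univ) (t := univ.image f) (g := f) (by simp)]
  refine sum_congr rfl fun c hc => ?_
  obtain ⟨i, -, rfl⟩ := mem_image.1 hc
  have key (y : ι → ℝ) : ∑ j with f j = f i, (if p (f j) then y j else 0) =
      if p (f i) then ∑ j with f j = f i, y j else 0 := by
    split_ifs with h
    · exact sum_congr rfl fun j hj => by rw [(mem_filter.1 hj).2, if_pos h]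
    · exact sum_eq_zero fun j hj => by rw [(mem_filter.1 hj).2, if_neg h]
  have h := sum_fiber_mul_fiberAverage f x 1 i
  simp only [Pi.one_apply, one_mul, sum_const, nsmul_eq_mul, mul_one] at h
  rw [key, key, h, mul_div_cancel_left₀ _ (card_fiber_pos f i).ne']

theorem antitone_fiberAverage [LinearOrder ι] {f x : ι → ℝ} (hf : Antitone f)
    (hx : Antitone x) : Antitone (fiberAverage f x) := by
  intro i j hij
  rcases (hf hij).eq_or_lt with h | h
  · exact (fiberAverage_congr f x h).le
  rw [fiberAverage, fiberAverage, div_le_div_iff₀ (card_fiber_pos f j) (card_fiber_pos f i)]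
  have hle : ∑ a with f a = f j, ∑ _b with f _b = f i, x a ≤
      ∑ _a with f _a = f j, ∑ b with f b = f i, x b := by
    refine sum_le_sum fun a ha => sum_le_sum fun b hb => hx ?_
    by_contra! hab
    have := hf hab.le
    rw [(mem_filter.1 ha).2, (mem_filter.1 hb).2] at this
    exact this.not_gt h
  simp only [sum_const, nsmul_eq_mul, ← mul_sum] at hle
  linarith

end FiberAverage

section DominantWeightPolytope

open Finset Filter Topology

variable {n : ℕ}

theorem mem_domWtPolytopeA_iff {x v : Fin n → ℝ} :
    v ∈ domWtPolytopeA n x ↔ Antitone v ∧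
      (∀ k : Fin n, ∑ i with i < k, v i ≤ ∑ i with i < k, x i) ∧ ∑ i, v i = ∑ i, x i := by
  refine and_congr ⟨fun h i j => h i j, fun h i j => @h i j⟩ (and_congr_left fun _ => ?_)
  simp only [sum_filter]
  constructor
  · intro h k
    rcases Nat.eq_zero_or_pos (k : ℕ) with hk | hk
    · simp [Fin.lt_def, hk]
    · exact h k hk (by omega)
  · intro h k hk hkn
    exact h ⟨k, by omega⟩

theorem sum_le_sum_of_isLowerSet {x v : Fin n → ℝ} (hv : v ∈ domWtPolytopeA n x)
    (p : Fin n → Prop) [DecidablePred p] (hp : ∀ i j, i ≤ j → p j → p i) :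
    ∑ i with p i, v i ≤ ∑ i with p i, x i := by
  obtain ⟨-, hpart, htot⟩ := mem_domWtPolytopeA_iff.1 hv
  by_cases hall : ∀ i, p i
  · simp [hall, htot]
  · obtain ⟨k, hk, hmin⟩ : ∃ k, ¬ p k ∧ ∀ j < k, p j := by
      push Not at hall
      obtain ⟨k, hk, hmin⟩ := WellFounded.has_min (wellFounded_lt (α := Fin n)) {i | ¬ p i} hall
      exact ⟨k, hk, fun j hj => by_contra fun h => hmin j h hj⟩
    have hset : (univ.filter p) = univ.filter (· < k) := by
      ext i
      simp only [mem_filter, mem_univ, true_and]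
      exact ⟨fun hi => lt_of_not_ge fun hki => hk (hp k i hki hi), hmin i⟩
    rw [hset]
    exact hpart k

theorem fiberAverage_mem_domWtPolytopeA {f x : Fin n → ℝ} (hf : Antitone f) (hx : Antitone x) :
    fiberAverage f x ∈ domWtPolytopeA n x := by
  refine mem_domWtPolytopeA_iff.2 ⟨antitone_fiberAverage hf hx, fun k => ?_, ?_⟩
  · have hw : Antitone fun i : Fin n => if i < k then (1 : ℝ) else 0 := by
      intro i j hij
      dsimp only
      split_ifs with hj hi
      · rfl
      · exact absurd (hij.trans_lt hj) hi
      · exact zero_le_one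
      · rfl
    simpa [sum_filter] using sum_mul_fiberAverage_le f hx hw
  · simpa using sum_filter_fiberAverage f x fun _ => True

/-- The partial sums of a point of the polytope of `x` are dominated by those of the average of
`x` over the level sets of that point. -/
theorem mem_domWtPolytopeA_fiberAverage {x v : Fin n → ℝ} (hx : Antitone x)
    (hv : v ∈ domWtPolytopeA n x) : v ∈ domWtPolytopeA n (fiberAverage v x) := by
  obtain ⟨hanti, -, htot⟩ := mem_domWtPolytopeA_iff.1 hv
  have hy := (mem_domWtPolytopeA_iff.1 (fiberAverage_mem_domWtPolytopeA hanti hx)).2.2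
  refine mem_domWtPolytopeA_iff.2 ⟨hanti, fun k => ?_, htot.trans hy.symm⟩
  set e : Fin n → ℝ := fun i => fiberAverage v x i - v i with he
  have he_level {i} (hi : v i = v k) : e i = e k := by
    simp only [he, hi, fiberAverage_congr v x hi]
  rw [← sub_nonneg, ← sum_sub_distrib]
  change 0 ≤ ∑ i with i < k, e i
  have hstrict : 0 ≤ ∑ i with v k < v i, e i := by
    rw [sum_sub_distrib, sum_filter_fiberAverage v x fun t => v k < t, sub_nonneg]
    exact sum_le_sum_of_isLowerSet hv _ fun i j hij hj => hj.trans_le (hanti hij)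
  have hweak : 0 ≤ ∑ i with v k ≤ v i, e i := by
    rw [sum_sub_distrib, sum_filter_fiberAverage v x fun t => v k ≤ t, sub_nonneg]
    exact sum_le_sum_of_isLowerSet hv _ fun i j hij hj => hj.trans (hanti hij)
  rcases le_total 0 (e k) with hek | hek
  · refine hstrict.trans (sum_le_sum_of_subset_of_nonneg (fun i hi => ?_) fun i hi hni => ?_)
    · simp only [mem_filter, mem_univ, true_and] at hi ⊢
      exact lt_of_not_ge fun hki => (hanti hki).not_gt hi
    · simp only [mem_filter, mem_univ, true_and, not_lt] at hi hni
      rw [he_level (le_antisymm hni (hanti hi.le))]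
      exact hek
  · have hsub : ({i | i < k} : Finset (Fin n)) ⊆ ({i | v k ≤ v i} : Finset (Fin n)) := by
      intro i hi
      simp only [mem_filter, mem_univ, true_and] at hi ⊢
      exact hanti hi.le
    rw [← sum_sdiff hsub] at hweak
    have hrest : ∑ i ∈ ({i | v k ≤ v i} : Finset (Fin n)) \ ({i | i < k} : Finset (Fin n)),
        e i ≤ 0 := by
      refine sum_nonpos fun i hi => ?_
      simp only [Finset.mem_sdiff, mem_filter, mem_univ, true_and, not_lt] at hi
      rw [he_level (le_antisymm (hanti hi.2) hi.1)]
      exact hek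
    linarith

/-- An extreme point of the polytope of `x` is the average of `x` over its own level sets. -/
theorem fiberAverage_eq_of_mem_extremePoints {x v : Fin n → ℝ} (hx : Antitone x)
    (hv : v ∈ (domWtPolytopeA n x).extremePoints ℝ) : fiberAverage v x = v := by
  obtain ⟨hvD, hext⟩ := hv
  obtain ⟨hanti, hpart, htot⟩ := mem_domWtPolytopeA_iff.1 hvD
  have hyD := fiberAverage_mem_domWtPolytopeA hanti hx
  obtain ⟨-, hvy, hvytot⟩ := mem_domWtPolytopeA_iff.1 (mem_domWtPolytopeA_fiberAverage hx hvD)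
  have hsmall : ∀ᶠ ε : ℝ in 𝓝[>] 0, ∀ i j : Fin n, i ≤ j →
      v j - ε * (fiberAverage v x j - v j) ≤ v i - ε * (fiberAverage v x i - v i) := by
    refine eventually_all.2 fun i => eventually_all.2 fun j => ?_
    by_cases hij : i ≤ j
    · rcases (hanti hij).eq_or_lt with h | h
      · exact Eventually.of_forall fun ε _ => by rw [fiberAverage_congr v x h, h]
      · have hlim (l : Fin n) : Tendsto (fun ε : ℝ => v l - ε * (fiberAverage v x l - v l))
            (𝓝[>] 0) (𝓝 (v l)) := by
          have hc : Continuous fun ε : ℝ => v l - ε * (fiberAverage v x l - v l) := by fun_prop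
          simpa using (hc.tendsto 0).mono_left nhdsWithin_le_nhds
        filter_upwards [(hlim j).eventually_lt (hlim i) h] with ε hε _ using hε.le
    · exact Eventually.of_forall fun ε h => absurd h hij
  obtain ⟨ε, hε, hεpos : 0 < ε⟩ := (hsmall.and self_mem_nhdsWithin).exists
  have hzD : (fun i => v i - ε * (fiberAverage v x i - v i)) ∈ domWtPolytopeA n x := by
    refine mem_domWtPolytopeA_iff.2 ⟨fun i j hij => hε i j hij, fun k => ?_, ?_⟩
    · rw [sum_sub_distrib, ← mul_sum, sum_sub_distrib]
      have := mul_nonneg hεpos.le (sub_nonneg.2 (hvy k))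
      linarith [hpart k]
    · rw [sum_sub_distrib, ← mul_sum, sum_sub_distrib, hvytot, sub_self, mul_zero, sub_zero,
        ← hvytot, htot]
  refine hext hyD hzD ⟨ε / (1 + ε), 1 / (1 + ε), by positivity, by positivity, ?_, ?_⟩
  · field_simp
    ring
  · funext i
    simp only [Pi.add_apply, Pi.smul_apply, smul_eq_mul]
    field_simp
    ring

theorem add_mem_domWtPolytopeA {x y a b : Fin n → ℝ} (ha : a ∈ domWtPolytopeA n x)
    (hb : b ∈ domWtPolytopeA n y) : a + b ∈ domWtPolytopeA n (x + y) := by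
  rw [mem_domWtPolytopeA_iff] at *
  refine ⟨ha.1.add hb.1, fun k => ?_, ?_⟩
  · simpa only [Pi.add_apply, sum_add_distrib] using add_le_add (ha.2.1 k) (hb.2.1 k)
  · simp only [Pi.add_apply, sum_add_distrib, ha.2.2, hb.2.2]

end DominantWeightPolytope

/-- If a sum `a + b` is extreme in a set containing all `a' + b` with `a' ∈ A`, then `a` is
extreme in `A`. -/
theorem mem_extremePoints_of_add {E : Type*} [AddCommGroup E] [Module ℝ E] {A C : Set E} {a b : E}
    (ha : a ∈ A) (hAC : ∀ a' ∈ A, a' + b ∈ C) (hab : a + b ∈ C.extremePoints ℝ) :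
    a ∈ A.extremePoints ℝ := by
  refine ⟨ha, fun u hu w hw huw => ?_⟩
  obtain ⟨s, t, hs, ht, hst, rfl⟩ := huw
  refine add_right_cancel (hab.2 (hAC u hu) (hAC w hw) ⟨s, t, hs, ht, hst, ?_⟩)
  rw [smul_add, smul_add, add_add_add_comm, ← add_smul, hst, one_smul]

/-- Context: n ≥ 1, λ, ν ∈ ℝⁿ weakly decreasing.
STATEMENT 12: every extreme point of D_{λ+ν} is a + b with a an extreme point
of D_λ and b an extreme point of D_ν. -/
theorem stmt12 (n : ℕ) (hn : 1 ≤ n) (lam nu : Fin n → ℝ)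
    (hlam : ∀ i j : Fin n, i ≤ j → lam j ≤ lam i)
    (hnu : ∀ i j : Fin n, i ≤ j → nu j ≤ nu i) :
    ∀ mu ∈ Set.extremePoints ℝ (domWtPolytopeA n (lam + nu)),
      ∃ a ∈ Set.extremePoints ℝ (domWtPolytopeA n lam),
        ∃ b ∈ Set.extremePoints ℝ (domWtPolytopeA n nu), mu = a + b := by
  intro mu hmu
  have hlam' : Antitone lam := fun i j => hlam i j
  have hnu' : Antitone nu := fun i j => hnu i j
  have hmu_anti : Antitone mu := (mem_domWtPolytopeA_iff.1 hmu.1).1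
  have hsum : mu = fiberAverage mu lam + fiberAverage mu nu := by
    rw [← fiberAverage_add]
    exact (fiberAverage_eq_of_mem_extremePoints (hlam'.add hnu') hmu).symm
  have ha := fiberAverage_mem_domWtPolytopeA hmu_anti hlam'
  have hb := fiberAverage_mem_domWtPolytopeA hmu_anti hnu'
  refine ⟨_, mem_extremePoints_of_add ha (fun a' ha' => add_mem_domWtPolytopeA ha' hb)
    (hsum ▸ hmu), _, mem_extremePoints_of_add hb (C := domWtPolytopeA n (lam + nu))
    (b := fiberAverage mu lam) (fun b' hb' => ?_) ?_, hsum⟩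
  · rw [add_comm b']
    exact add_mem_domWtPolytopeA ha hb'
  · rw [add_comm (fiberAverage mu nu), ← hsum]
    exact hmu
end

section
/- The origin 0 belongs to D and is an extreme point of D. (This is the paper's Claim 3.2: 0 is a vertex of the dominant weight polytope 𝒟_{2λ} in type D.) -/
/-- The coordinates of a type D dominant vector, except possibly the last, are nonnegative.
Here `p` and `l` are the last but one and the last index. -/
theorem nonneg_of_dominant {n : ℕ} {p l : Fin n} (hp : (p : ℕ) = n - 2) {μ : Fin n → ℝ}
    (h₁ : ∀ i j : Fin n, i ≤ j → (j : ℕ) ≤ n - 2 → μ j ≤ μ i)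
    (h₂ : |μ l| ≤ μ p) (i : Fin n) (hi : (i : ℕ) < n - 1) : 0 ≤ μ i :=
  ((abs_nonneg _).trans h₂).trans <| h₁ i p (Fin.le_def.2 (by omega)) hp.le

/-- Splitting off the last summand. -/
theorem sum_eq_sum_ite_lt_add_last {n : ℕ} {l : Fin n} (hl : (l : ℕ) = n - 1) (f : Fin n → ℝ) :
    ∑ i, f i = (∑ i : Fin n, if (i : ℕ) < n - 1 then f i else 0) + f l := by
  have hlast : f l = ∑ i : Fin n, if i = l then f i else 0 := by simp
  rw [hlast, ← Finset.sum_add_distrib]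
  refine Finset.sum_congr rfl fun i _ => ?_
  by_cases h : (i : ℕ) < n - 1
  · have : i ≠ l := fun e => by omega
    simp [h, this]
  · have : i = l := Fin.ext (by omega)
    simp [this, hl]

/-- If a positive combination of two type D dominant vectors vanishes, then so does the first
of them. -/
theorem eq_zero_of_dominant_of_combination_eq_zero {n : ℕ} (hn : 2 ≤ n) {p l : Fin n}
    (hp : (p : ℕ) = n - 2) (hl : (l : ℕ) = n - 1) {μ ν : Fin n → ℝ}
    (hμ₁ : ∀ i j : Fin n, i ≤ j → (j : ℕ) ≤ n - 2 → μ j ≤ μ i) (hμ₂ : |μ l| ≤ μ p)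
    (hν₁ : ∀ i j : Fin n, i ≤ j → (j : ℕ) ≤ n - 2 → ν j ≤ ν i) (hν₂ : |ν l| ≤ ν p)
    {a b : ℝ} (ha : 0 < a) (hb : 0 < b) (h : a • μ + b • ν = 0) : μ = 0 := by
  have hinit : ∀ i : Fin n, (i : ℕ) < n - 1 → μ i = 0 := fun i hi => by
    have hμ := nonneg_of_dominant hp hμ₁ hμ₂ i hi
    have hν := nonneg_of_dominant hp hν₁ hν₂ i hi
    have hi := congrFun h i
    simp only [Pi.add_apply, Pi.smul_apply, smul_eq_mul, Pi.zero_apply] at hi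
    have hbν := mul_nonneg hb.le hν
    exact le_antisymm (nonpos_of_mul_nonpos_right (by linarith) ha) hμ
  funext i
  by_cases hi : (i : ℕ) < n - 1
  · exact hinit i hi
  · have hi : i = l := Fin.ext (by omega)
    rw [hinit p (by omega)] at hμ₂
    rw [hi]
    exact abs_nonpos_iff.1 hμ₂

/-- Context: n ≥ 2 and λ ∈ ℝⁿ type D dominant, i.e. λ_1 ≥ ... ≥ λ_{n-1} ≥ |λ_n|
(0-based indices 0,...,n-1 here). D is the set of type D dominant μ with
2λ - μ in the nonnegative cone spanned by the type D simple roots, expressed by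
the partial-sum inequalities.
STATEMENT 13: 0 belongs to D and is an extreme point of D. -/
theorem stmt13 (n : ℕ) (hn : 2 ≤ n) (lam : Fin n → ℝ)
    (hlam1 : ∀ i j : Fin n, i ≤ j → (j : ℕ) ≤ n - 2 → lam j ≤ lam i)
    (hlam2 : |lam ⟨n - 1, by omega⟩| ≤ lam ⟨n - 2, by omega⟩) :
    (0 : Fin n → ℝ) ∈
      {μ : Fin n → ℝ | (∀ i j : Fin n, i ≤ j → (j : ℕ) ≤ n - 2 → μ j ≤ μ i) ∧
        |μ ⟨n - 1, by omega⟩| ≤ μ ⟨n - 2, by omega⟩ ∧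
        (∀ k, 1 ≤ k → k ≤ n - 2 →
          0 ≤ ∑ i : Fin n, if (i : ℕ) < k then 2 * lam i - μ i else 0) ∧
        0 ≤ (∑ i : Fin n, if (i : ℕ) < n - 1 then 2 * lam i - μ i else 0)
            - (2 * lam ⟨n - 1, by omega⟩ - μ ⟨n - 1, by omega⟩) ∧
        0 ≤ ∑ i : Fin n, (2 * lam i - μ i)} ∧
    (0 : Fin n → ℝ) ∈ Set.extremePoints ℝ
      {μ : Fin n → ℝ | (∀ i j : Fin n, i ≤ j → (j : ℕ) ≤ n - 2 → μ j ≤ μ i) ∧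
        |μ ⟨n - 1, by omega⟩| ≤ μ ⟨n - 2, by omega⟩ ∧
        (∀ k, 1 ≤ k → k ≤ n - 2 →
          0 ≤ ∑ i : Fin n, if (i : ℕ) < k then 2 * lam i - μ i else 0) ∧
        0 ≤ (∑ i : Fin n, if (i : ℕ) < n - 1 then 2 * lam i - μ i else 0)
            - (2 * lam ⟨n - 1, by omega⟩ - μ ⟨n - 1, by omega⟩) ∧
        0 ≤ ∑ i : Fin n, (2 * lam i - μ i)} := by
  refine (and_iff_left_of_imp fun hmem => ?_).2 ?_
  · refine mem_extremePoints_iff_left.2 ⟨hmem, ?_⟩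
    rintro μ ⟨hμ₁, hμ₂, -⟩ ν ⟨hν₁, hν₂, -⟩ ⟨a, b, ha, hb, -, h⟩
    exact eq_zero_of_dominant_of_combination_eq_zero hn rfl rfl hμ₁ hμ₂ hν₁ hν₂ ha hb h
  · have hnonneg : ∀ k ≤ n - 1, ∀ i : Fin n,
        0 ≤ if (i : ℕ) < k then 2 * lam i - (0 : Fin n → ℝ) i else 0 := fun k hk i => by
      split_ifs with hi
      · have := nonneg_of_dominant rfl hlam1 hlam2 i (by omega)
        simpa using this
      · exact le_rfl
    have hpenult := Finset.single_le_sum (fun i _ => hnonneg (n - 1) le_rfl i)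
      (Finset.mem_univ (⟨n - 2, by omega⟩ : Fin n))
    rw [if_pos (by simp only; omega)] at hpenult
    obtain ⟨hlower, hupper⟩ := abs_le.1 hlam2
    refine ⟨fun _ _ _ _ => le_rfl, by simp, fun k _ hk =>
      Finset.sum_nonneg fun i _ => hnonneg k (by omega) i, ?_, ?_⟩
    · simp only [Pi.zero_apply] at hpenult ⊢
      linarith
    · rw [sum_eq_sum_ite_lt_add_last (l := ⟨n - 1, by omega⟩) rfl]
      simp only [Pi.zero_apply] at hpenult ⊢
      linarith
end

section
/- The vector μ is an extreme point of the type A dominant weight polytope D_{2λ} = {ν ∈ ℝ^n : ν_1 ≥ ... ≥ ν_n, Σ_{i=1}^k ν_i ≤ 2Σ_{i=1}^k λ_i for all 1 ≤ k ≤ n-1, and Σ_{i=1}^n ν_i = 2Σ_{i=1}^n λ_i}. -/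
/-- The sum of the first `k` entries of a real vector. -/
def prefixSum {n : ℕ} (v : Fin n → ℝ) (k : ℕ) : ℝ :=
  ∑ i : Fin n, if (i : ℕ) < k then v i else 0

lemma prefixSum_zero {n : ℕ} (v : Fin n → ℝ) : prefixSum v 0 = 0 := by
  simp [prefixSum]

lemma prefixSum_self {n : ℕ} (v : Fin n → ℝ) : prefixSum v n = ∑ i, v i := by
  simp [prefixSum]

lemma prefixSum_succ {n : ℕ} (v : Fin n → ℝ) (j : Fin n) :
    prefixSum v (j + 1) = prefixSum v j + v j := by
  have hsingle : ∑ i : Fin n, (if i = j then v i else 0) = v j := by simp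
  rw [prefixSum, prefixSum, ← hsingle, ← Finset.sum_add_distrib]
  refine Finset.sum_congr rfl fun i _ => ?_
  rcases lt_trichotomy i j with h | h | h
  · have h' : (i : ℕ) < j := h
    simp [h.ne, h', h'.trans (Nat.lt_succ_self _)]
  · simp [h]
  · have h' : (j : ℕ) < i := h
    simp [h.ne', h'.not_gt, Nat.not_lt.2 (Nat.succ_le_of_lt h')]

lemma prefixSum_smul_add_smul {n : ℕ} (a b : ℝ) (v w : Fin n → ℝ) (k : ℕ) :
    prefixSum (a • v + b • w) k = a * prefixSum v k + b * prefixSum w k := by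
  simp only [prefixSum, Finset.mul_sum, ← Finset.sum_add_distrib]
  refine Finset.sum_congr rfl fun i _ => ?_
  split_ifs <;> simp

/-- A proper convex combination of two numbers bounded by `r` attains `r` only if both do. -/
lemma eq_of_convex_combination_eq_upper_bound {a b p q r : ℝ} (ha : 0 < a) (hb : 0 < b)
    (hab : a + b = 1) (hp : p ≤ r) (hq : q ≤ r) (h : a * p + b * q = r) : p = r := by
  refine le_antisymm hp (le_of_mul_le_mul_left ?_ ha)
  have hbq := mul_le_mul_of_nonneg_left hq hb.le
  have hr : a * r + b * r = r := by rw [← add_mul, hab, one_mul]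
  linarith

/-- Context: n ≥ 3, λ ∈ ℝⁿ weakly decreasing, 1 ≤ m ≤ n-2 (1-based), and
μ_j = (2/3)(λ_m + λ_{m+1} + λ_{m+2}) for 1-based j ∈ {m, m+1, m+2},
μ_j = 2λ_j otherwise.  (Fin n is 0-based, so 1-based index j is (j : ℕ) + 1.)
STATEMENT 14: μ is an extreme point of the type A dominant weight polytope
D_{2λ}. -/
theorem stmt14 (n m : ℕ) (hn : 3 ≤ n) (hm1 : 1 ≤ m) (hm2 : m + 2 ≤ n)
    (lam mu : Fin n → ℝ)
    (hlam : ∀ i j : Fin n, i ≤ j → lam j ≤ lam i)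
    (hmu : ∀ j : Fin n,
      (m ≤ (j : ℕ) + 1 ∧ (j : ℕ) + 1 ≤ m + 2 →
        mu j = 2 / 3 * (lam ⟨m - 1, by omega⟩ + lam ⟨m, by omega⟩
          + lam ⟨m + 1, by omega⟩)) ∧
      (¬(m ≤ (j : ℕ) + 1 ∧ (j : ℕ) + 1 ≤ m + 2) → mu j = 2 * lam j)) :
    mu ∈ Set.extremePoints ℝ
      {ν : Fin n → ℝ | (∀ i j : Fin n, i ≤ j → ν j ≤ ν i) ∧
        (∀ k, 1 ≤ k → k ≤ n - 1 →
          (∑ i : Fin n, if (i : ℕ) < k then ν i else 0) ≤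
            2 * ∑ i : Fin n, if (i : ℕ) < k then lam i else 0) ∧
        (∑ i, ν i) = 2 * ∑ i, lam i} := by
  obtain ⟨d, rfl⟩ : ∃ d, m = d + 1 := ⟨m - 1, by omega⟩
  simp only [Nat.add_sub_cancel] at hmu
  set i₀ : Fin n := ⟨d, by omega⟩ with hi₀
  set i₁ : Fin n := ⟨d + 1, by omega⟩ with hi₁
  set i₂ : Fin n := ⟨d + 1 + 1, by omega⟩ with hi₂
  have hmid : ∀ j : Fin n, d ≤ (j : ℕ) → (j : ℕ) ≤ d + 2 →
      mu j = 2 / 3 * (lam i₀ + lam i₁ + lam i₂) :=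
    fun j h₁ h₂ => (hmu j).1 ⟨by omega, by omega⟩
  have hout : ∀ j : Fin n, ((j : ℕ) < d ∨ d + 2 < (j : ℕ)) → mu j = 2 * lam j :=
    fun j h => (hmu j).2 (by omega)
  have hmu₀ := hmid i₀ (by simp [hi₀]) (by simp [hi₀])
  have hmu₁ := hmid i₁ (by simp [hi₁]) (by simp [hi₁])
  have hmu₂ := hmid i₂ (by simp [hi₂]; omega) (by simp [hi₂])
  have hl₀₁ : lam i₁ ≤ lam i₀ := hlam _ _ (Fin.mk_le_mk.2 (by omega))
  have hl₁₂ : lam i₂ ≤ lam i₁ := hlam _ _ (Fin.mk_le_mk.2 (by omega))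
  have hstep : ∀ v : Fin n → ℝ, prefixSum v (d + 1) = prefixSum v d + v i₀ ∧
      prefixSum v (d + 2) = prefixSum v (d + 1) + v i₁ ∧
      prefixSum v (d + 3) = prefixSum v (d + 2) + v i₂ :=
    fun v => ⟨prefixSum_succ v i₀, prefixSum_succ v i₁, prefixSum_succ v i₂⟩
  have hlow : ∀ k, k ≤ d → prefixSum mu k = 2 * prefixSum lam k := by
    intro k
    induction k with
    | zero => simp [prefixSum_zero]
    | succ k ih =>
      intro hk
      have h₁ := prefixSum_succ mu ⟨k, by omega⟩
      have h₂ := prefixSum_succ lam ⟨k, by omega⟩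
      have h₃ := hout ⟨k, by omega⟩ (Or.inl hk)
      simp only at h₁ h₂
      linarith [ih (by omega)]
  obtain ⟨hm₁, hm₂, hm₃⟩ := hstep mu
  obtain ⟨hl₁, hl₂, hl₃⟩ := hstep lam
  have hd := hlow d le_rfl
  have hhigh : ∀ k, d + 3 ≤ k → k ≤ n → prefixSum mu k = 2 * prefixSum lam k := by
    intro k hk
    induction k, hk using Nat.le_induction with
    | base => intro _; linarith
    | succ k hk ih =>
      intro hkn
      have h₁ := prefixSum_succ mu ⟨k, by omega⟩
      have h₂ := prefixSum_succ lam ⟨k, by omega⟩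
      have h₃ := hout ⟨k, by omega⟩ (Or.inr hk)
      simp only at h₁ h₂
      linarith [ih (by omega)]
  have hle : ∀ k, k ≤ n → prefixSum mu k ≤ 2 * prefixSum lam k := by
    intro k hk
    obtain h | h | h | h : k ≤ d ∨ k = d + 1 ∨ k = d + 2 ∨ d + 3 ≤ k := by omega
    · exact (hlow k h).le
    · subst h; linarith
    · subst h; linarith
    · exact (hhigh k h hk).le
  rw [mem_extremePoints_iff_left]
  refine ⟨⟨?_, fun k _ hk => hle k (by omega), ?_⟩, ?_⟩
  · intro i j hij
    have hij' : (i : ℕ) ≤ j := hij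
    have hlij := hlam i j hij
    have hupper : ∀ k : Fin n, (k : ℕ) < d → lam i₀ ≤ lam k :=
      fun k hk => hlam _ _ (Fin.mk_le_mk.2 hk.le)
    have hlower : ∀ k : Fin n, d + 2 < (k : ℕ) → lam k ≤ lam i₂ :=
      fun k hk => hlam _ _ (Fin.mk_le_mk.2 hk.le)
    by_cases hi : (i : ℕ) < d ∨ d + 2 < (i : ℕ) <;> by_cases hj : (j : ℕ) < d ∨ d + 2 < (j : ℕ)
    · rw [hout i hi, hout j hj]; linarith
    · rw [hout i hi, hmid j (by omega) (by omega)]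
      linarith [hupper i (by omega)]
    · rw [hmid i (by omega) (by omega), hout j hj]
      linarith [hlower j (by omega)]
    · rw [hmid i (by omega) (by omega), hmid j (by omega) (by omega)]
  · rw [← prefixSum_self, ← prefixSum_self]
    exact hhigh n (by omega) le_rfl
  · rintro x ⟨hxa, hxs, hxt⟩ y ⟨hya, hys, hyt⟩ ⟨a, b, ha, hb, hab, hxy⟩
    have hbound : ∀ v : Fin n → ℝ, (∀ k, 1 ≤ k → k ≤ n - 1 → prefixSum v k ≤ 2 * prefixSum lam k) →
        ∑ i, v i = 2 * ∑ i, lam i → ∀ k, k ≤ n → prefixSum v k ≤ 2 * prefixSum lam k := by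
      intro v hvs hvt k hk
      obtain rfl | rfl | h : k = 0 ∨ k = n ∨ (1 ≤ k ∧ k ≤ n - 1) := by omega
      · simp [prefixSum_zero]
      · rw [prefixSum_self, prefixSum_self, hvt]
      · exact hvs k h.1 h.2
    have htight : ∀ k, k ≤ n → prefixSum mu k = 2 * prefixSum lam k →
        prefixSum x k = prefixSum mu k := by
      intro k hk hmk
      rw [hmk]
      refine eq_of_convex_combination_eq_upper_bound ha hb hab
        (hbound x hxs hxt k hk) (hbound y hys hyt k hk) ?_
      rw [← prefixSum_smul_add_smul, hxy, hmk]
    have hflat : ∀ i j : Fin n, i ≤ j → mu i = mu j → x j = x i := by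
      intro i j hij hmij
      have hi := congrFun hxy i
      have hj := congrFun hxy j
      simp only [Pi.add_apply, Pi.smul_apply, smul_eq_mul] at hi hj
      have hx := hxa i j hij
      have hy := mul_le_mul_of_nonneg_left (hya i j hij) hb.le
      refine le_antisymm hx (le_of_mul_le_mul_left ?_ ha)
      linarith
    have hx₀₁ := hflat i₀ i₁ (Fin.mk_le_mk.2 (by omega)) (hmu₀.trans hmu₁.symm)
    have hx₁₂ := hflat i₁ i₂ (Fin.mk_le_mk.2 (by omega)) (hmu₁.trans hmu₂.symm)
    obtain ⟨hx₁, hx₂, hx₃⟩ := hstep x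
    have hxd := htight d (by omega) hd
    have hxd₃ := htight (d + 3) (by omega) (hhigh _ le_rfl (by omega))
    funext j
    by_cases hj : (j : ℕ) < d ∨ d + 2 < (j : ℕ)
    · have hedge : ∀ k, k = (j : ℕ) ∨ k = j + 1 → prefixSum x k = prefixSum mu k := by
        intro k hk
        have hkn : k ≤ n := by omega
        refine htight k hkn ?_
        rcases hj with h | h
        · exact hlow k (by omega)
        · exact hhigh k (by omega) hkn
      linarith [prefixSum_succ x j, prefixSum_succ mu j, hedge j (Or.inl rfl),
        hedge (j + 1) (Or.inr rfl)]
    · rw [hmid j (by omega) (by omega)]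
      obtain rfl | rfl | rfl : j = i₀ ∨ j = i₁ ∨ j = i₂ := by
        simp only [Fin.ext_iff, hi₀, hi₁, hi₂]; omega
      all_goals linarith
end
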